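/- arXiv:2411.06233 — 4 statements merged into one kernel-verified Lean document; each statement's English description precedes it below -/
import Mathlib

section
/- Let V be a finite-dimensional real vector space, g a positive-definite symmetric bilinear form on V, y ∈ V with y ≠ 0, and h(X,Z) := g(X,Z) − g(X,y)g(Z,y)/g(y,y) the angular metric. Let C be a symmetric trilinear form on V which is quasi-C-reducible, i.e., there is a linear functional c on V with C(X,Y,Z) = h(X,Y)c(Z) + h(Y,Z)c(X) + h(Z,X)c(Y) for all X,Y,Z ∈ V. If some vector B ∈ V, linearly independent from y, satisfies the SC-condition C(B,X,Y) = 0 for all X,Y ∈ V, then c = 0 and hence C = 0. -/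
/-- The angular metric is positive on vectors linearly independent from the supporting element. -/
theorem angular_metric_self_pos {V : Type*} [AddCommGroup V] [Module ℝ V]
    (g : V →ₗ[ℝ] V →ₗ[ℝ] ℝ) (hgsymm : ∀ X Z : V, g X Z = g Z X)
    (hgpos : ∀ X : V, X ≠ 0 → 0 < g X X) {B y : V} (hyy : g y y ≠ 0)
    (hBy : LinearIndependent ℝ ![B, y]) :
    0 < g B B - g B y * g B y / g y y := by
  have hne : B - (g B y / g y y) • y ≠ 0 := by
    intro h0
    have := LinearIndependent.pair_iff.mp hBy 1 (-(g B y / g y y))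
      (by rw [one_smul, neg_smul, ← sub_eq_add_neg, h0])
    exact one_ne_zero this.1
  convert hgpos _ hne using 1
  simp only [map_sub, map_smul, LinearMap.sub_apply, LinearMap.smul_apply, smul_eq_mul,
    hgsymm y B]
  field_simp
  ring

/-- Pointwise model of Theorem 3.1: a quasi-C-reducible Cartan tensor admitting a
semi-concurrent vector `B` (linearly independent from the supporting element `y`)
vanishes. -/
theorem quasi_C_reducible_SC_implies_riemannian
    (V : Type*) [AddCommGroup V] [Module ℝ V] [FiniteDimensional ℝ V]
    (g : V →ₗ[ℝ] V →ₗ[ℝ] ℝ)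
    (hgsymm : ∀ X Z : V, g X Z = g Z X)
    (hgpos : ∀ X : V, X ≠ 0 → 0 < g X X)
    (y : V) (hy : y ≠ 0)
    (h : V → V → ℝ)
    (hdef : ∀ X Z : V, h X Z = g X Z - g X y * g Z y / g y y)
    (C : V →ₗ[ℝ] V →ₗ[ℝ] V →ₗ[ℝ] ℝ)
    (c : V →ₗ[ℝ] ℝ)
    (hquasi : ∀ X Y Z : V, C X Y Z = h X Y * c Z + h Y Z * c X + h Z X * c Y)
    (B : V) (hBy : LinearIndependent ℝ ![B, y])
    (hSC : ∀ X Y : V, C B X Y = 0) :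
    c = 0 ∧ C = 0 := by
  have hyy : 0 < g y y := hgpos y hy
  have hBB : 0 < h B B := by
    rw [hdef]
    exact angular_metric_self_pos g hgsymm hgpos hyy.ne' hBy
  have hcB : c B = 0 := by
    have hBBB := hquasi B B B
    rw [hSC] at hBBB
    have : h B B * c B = 0 := by linarith
    exact (mul_eq_zero.mp this).resolve_left hBB.ne'
  have hc : c = 0 := by
    ext Z
    have hBBZ := hquasi B B Z
    rw [hSC, hcB, mul_zero, mul_zero, add_zero, add_zero] at hBBZ
    exact (mul_eq_zero.mp hBBZ.symm).resolve_left hBB.ne'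
  refine ⟨hc, ?_⟩
  ext X Y Z
  simp [hquasi, hc]
end

section
/- Let V be a finite-dimensional real vector space, g a positive-definite symmetric bilinear form on V, y ∈ V with y ≠ 0, and h(X,Z) := g(X,Z) − g(X,y)g(Z,y)/g(y,y) the angular metric. Let C be a symmetric trilinear form on V which is C3-like, i.e., there are linear functionals a, b, c on V with C(X,Y,Z) = h(X,Y)a(Z) + h(Y,Z)a(X) + h(Z,X)a(Y) + c(X)c(Y)b(Z) + c(Y)c(Z)b(X) + c(Z)c(X)b(Y) for all X,Y,Z ∈ V. Suppose a vector B ∈ V, linearly independent from y, satisfies the SC-condition C(B,X,Y) = 0 for all X,Y ∈ V, and that c(B) = 0. Then a = 0. -/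
/-- Pointwise model of the key step in Theorem 3.2: for a C3-like symmetric trilinear
form `C` and a semi-concurrent vector `B` linearly independent from `y` with `c(B) = 0`,
the covector `a` vanishes. -/
theorem C3_like_SC_implies_a_zero
    (V : Type*) [AddCommGroup V] [Module ℝ V] [FiniteDimensional ℝ V]
    (g : V →ₗ[ℝ] V →ₗ[ℝ] ℝ)
    (hgsymm : ∀ X Z : V, g X Z = g Z X)
    (hgpos : ∀ X : V, X ≠ 0 → 0 < g X X)
    (y : V) (hy : y ≠ 0)
    (h : V → V → ℝ)
    (hdef : ∀ X Z : V, h X Z = g X Z - g X y * g Z y / g y y)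
    (C : V →ₗ[ℝ] V →ₗ[ℝ] V →ₗ[ℝ] ℝ)
    (a b c : V →ₗ[ℝ] ℝ)
    (hC3 : ∀ X Y Z : V, C X Y Z =
      h X Y * a Z + h Y Z * a X + h Z X * a Y +
      c X * c Y * b Z + c Y * c Z * b X + c Z * c X * b Y)
    (B : V) (hBy : LinearIndependent ℝ ![B, y])
    (hSC : ∀ X Y : V, C B X Y = 0)
    (hcB : c B = 0) :
    a = 0 := by
  have hyy : 0 < g y y := hgpos y hy
  have hne : B - (g B y / g y y) • y ≠ 0 := by
    intro h0
    have := LinearIndependent.pair_iff.mp hBy 1 (-(g B y / g y y))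
      (by rw [one_smul, neg_smul, ← sub_eq_add_neg]; exact h0)
    exact one_ne_zero this.1
  have hBB : 0 < h B B := by
    have hpos := hgpos _ hne
    have heq : g (B - (g B y / g y y) • y) (B - (g B y / g y y) • y) = h B B := by
      simp only [map_sub, map_smul, LinearMap.sub_apply, LinearMap.smul_apply, smul_eq_mul,
        hdef, hgsymm y B]
      field_simp
      ring
    rwa [heq] at hpos
  have haB : a B = 0 := by
    have hB := hC3 B B B
    rw [hSC, hcB] at hB
    have : h B B * a B = 0 := by linarith
    exact (mul_eq_zero.mp this).resolve_left hBB.ne'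
  ext Y
  have hY := hC3 B B Y
  rw [hSC, hcB, haB] at hY
  have : h B B * a Y = 0 := by linarith
  exact (mul_eq_zero.mp this).resolve_left hBB.ne'
end

section
/- Let V be a finite-dimensional real vector space, C a symmetric trilinear form on V, K a linear functional on V, and B ∈ V with C(B,X,Y) = 0 for all X,Y ∈ V (the SC-condition). Let P be a 4-linear form on V such that: (i) P(W,X,Y,Z) = K(W)C(X,Y,Z) − K(X)C(Z,Y,W) for all W,X,Y,Z ∈ V (the P2-like condition), and (ii) P(B,X,Y,Z) = −C(X,Y,Z) for all X,Y,Z ∈ V (the contracted Ricci identity for the semi-concurrent vector B). If 1 + K(B) ≠ 0, then C = 0. -/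
/-- Pointwise algebraic core of Theorem 3.4: if `P(W,X,Y,Z) = K(W)C(X,Y,Z) − K(X)C(Z,Y,W)`
(the P2-like condition), `B` is semi-concurrent (`C(B,·,·) = 0`),
`P(B,X,Y,Z) = −C(X,Y,Z)` (contracted Ricci identity), and `1 + K(B) ≠ 0`, then `C = 0`. -/
theorem P2_like_SC_implies_riemannian
    (V : Type*) [AddCommGroup V] [Module ℝ V] [FiniteDimensional ℝ V]
    (C : V →ₗ[ℝ] V →ₗ[ℝ] V →ₗ[ℝ] ℝ)
    (hCsymm₁ : ∀ X Y Z : V, C X Y Z = C Y X Z)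
    (hCsymm₂ : ∀ X Y Z : V, C X Y Z = C X Z Y)
    (K : V →ₗ[ℝ] ℝ)
    (B : V) (hSC : ∀ X Y : V, C B X Y = 0)
    (P : V →ₗ[ℝ] V →ₗ[ℝ] V →ₗ[ℝ] V →ₗ[ℝ] ℝ)
    (hP2 : ∀ W X Y Z : V, P W X Y Z = K W * C X Y Z - K X * C Z Y W)
    (hricci : ∀ X Y Z : V, P B X Y Z = -C X Y Z)
    (hKB : 1 + K B ≠ 0) :
    C = 0 := by
  ext X Y Z
  have hCB : C Z Y B = 0 := by rw [hCsymm₂, hCsymm₁, hSC]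
  have hmul : (1 + K B) * C X Y Z = 0 := by
    linear_combination hricci X Y Z - hP2 B X Y Z + K X * hCB
  simpa using (mul_eq_zero.mp hmul).resolve_left hKB
end

section
/- Let V be a finite-dimensional real vector space, g a positive-definite symmetric bilinear form on V, y ∈ V with y ≠ 0, F₀ := √(g(y,y)), and l the linear functional l(X) := g(y,X)/F₀. Let C be a symmetric trilinear form on V, D a 4-linear form on V, and σ ∈ V such that: (i) C(σ,X,Y) = 0 for all X,Y ∈ V (the CC-condition), (ii) D(σ,X,Y,Z) = 0 for all X,Y,Z ∈ V, and (iii) the T-tensor vanishes: F₀·D(W,X,Y,Z) + l(W)C(X,Y,Z) + l(X)C(W,Y,Z) + l(Y)C(W,X,Z) + l(Z)C(W,X,Y) = 0 for all W,X,Y,Z ∈ V. If g(σ,y) ≠ 0, then C = 0. -/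
/-- Pointwise algebraic core of Theorem 3.6: under the CC-condition `C(σ,·,·) = 0`,
`D(σ,·,·,·) = 0`, vanishing T-tensor
`F₀·D(W,X,Y,Z) + l(W)C(X,Y,Z) + l(X)C(W,Y,Z) + l(Y)C(W,X,Z) + l(Z)C(W,X,Y) = 0`
(where `F₀ = √g(y,y)` and `l(X) = g(y,X)/F₀`), and `g(σ,y) ≠ 0`, the Cartan tensor
`C` vanishes. -/
theorem CC_condition_T_zero_implies_riemannian
    (V : Type*) [AddCommGroup V] [Module ℝ V] [FiniteDimensional ℝ V]
    (g : V →ₗ[ℝ] V →ₗ[ℝ] ℝ)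
    (hgsymm : ∀ X Z : V, g X Z = g Z X)
    (hgpos : ∀ X : V, X ≠ 0 → 0 < g X X)
    (y : V) (hy : y ≠ 0)
    (C : V →ₗ[ℝ] V →ₗ[ℝ] V →ₗ[ℝ] ℝ)
    (hCsymm₁ : ∀ X Y Z : V, C X Y Z = C Y X Z)
    (hCsymm₂ : ∀ X Y Z : V, C X Y Z = C X Z Y)
    (D : V →ₗ[ℝ] V →ₗ[ℝ] V →ₗ[ℝ] V →ₗ[ℝ] ℝ)
    (σ : V)
    (hCC : ∀ X Y : V, C σ X Y = 0)
    (hDσ : ∀ X Y Z : V, D σ X Y Z = 0)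
    (hT : ∀ W X Y Z : V,
      Real.sqrt (g y y) * D W X Y Z
        + (g y W / Real.sqrt (g y y)) * C X Y Z
        + (g y X / Real.sqrt (g y y)) * C W Y Z
        + (g y Y / Real.sqrt (g y y)) * C W X Z
        + (g y Z / Real.sqrt (g y y)) * C W X Y = 0)
    (hσy : g σ y ≠ 0) :
    C = 0 := by
  have hF : Real.sqrt (g y y) ≠ 0 := (Real.sqrt_pos.2 (hgpos y hy)).ne'
  have hlσ : g y σ / Real.sqrt (g y y) ≠ 0 := div_ne_zero (hgsymm y σ ▸ hσy) hF
  ext X Y Z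
  have h := hT σ X Y Z
  simp only [hDσ, hCC, mul_zero, zero_add, add_zero] at h
  simpa using (mul_eq_zero.1 h).resolve_left hlσ
end
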